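/- arXiv:2603.07094 — 2 statements merged into one kernel-verified Lean document; each statement's English description precedes it below -/
import Mathlib

section
/- For every state s and every collective strategy σ̄_Π for the team, there exists an opponent strategy such that the probability of reaching the target set T from s under the resulting strategy profile is at most w(s), where w denotes the pointwise limit of the value iteration sequence. In particular, no collective strategy guarantees reaching T from s with probability strictly greater than w(s) against every opponent strategy. -/
/-!
Common framework: team concurrent stochastic reachability games.
-/

noncomputable section

/-- A concurrent game structure: finitely many players, finitely many states,
finitely many actions per player, available actions, and a probabilistic
transition function. -/
structure GameStructure where
  Player : Type
  [playerFin : Fintype Player]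
  [playerDec : DecidableEq Player]
  State : Type
  [stateFin : Fintype State]
  [stateDec : DecidableEq State]
  Act : Player → Type
  [actFin : ∀ p, Fintype (Act p)]
  [actDec : ∀ p, DecidableEq (Act p)]
  Av : (p : Player) → State → Finset (Act p)
  av_nonempty : ∀ p s, (Av p s).Nonempty
  trans : State → ((p : Player) → Act p) → State → ℝ
  trans_nonneg : ∀ s a t, 0 ≤ trans s a t
  trans_sum : ∀ s a, ∑ t, trans s a t = 1

attribute [instance] GameStructure.playerFin GameStructure.playerDec
  GameStructure.stateFin GameStructure.stateDec GameStructure.actFin GameStructure.actDec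

/-- A (behavioural) strategy of player `p`: a distribution over available
actions, for every history `h` (the list of previously visited states)
and current state `s`. -/
structure Strategy (G : GameStructure) (p : G.Player) where
  toFun : List G.State → G.State → G.Act p → ℝ
  nonneg : ∀ h s a, 0 ≤ toFun h s a
  support_av : ∀ h s a, a ∉ G.Av p s → toFun h s a = 0
  sum_one : ∀ h s, ∑ a, toFun h s a = 1

/-- A strategy is memoryless if it only depends on the current state. -/
def Strategy.Memoryless {G : GameStructure} {p : G.Player} (σ : Strategy G p) : Prop :=
  ∀ h h' s, σ.toFun h s = σ.toFun h' s

/-- A strategy is deterministic if it always plays a single action with probability 1. -/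
def Strategy.Deterministic {G : GameStructure} {p : G.Player} (σ : Strategy G p) : Prop :=
  ∀ h s, ∃ a, σ.toFun h s a = 1

/-- A selector of player `p` at state `s`: a distribution over the available actions. -/
structure Selector (G : GameStructure) (p : G.Player) (s : G.State) where
  toFun : G.Act p → ℝ
  nonneg : ∀ a, 0 ≤ toFun a
  support_av : ∀ a, a ∉ G.Av p s → toFun a = 0
  sum_one : ∑ a, toFun a = 1

/-- A game: a game structure together with a team, an absorbing target set,
and an initial state. -/
structure Game extends GameStructure where
  team : Finset Player
  target : Finset State
  init : State
  absorbing : ∀ t ∈ target, ∀ a, trans t a t = 1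

namespace Game

variable (Gm : Game)

abbrev TeamPlayer := {p : Gm.Player // p ∈ Gm.team}
abbrev OppPlayer := {p : Gm.Player // p ∉ Gm.team}

/-- A collective strategy: one strategy for each team player. -/
abbrev TeamStrategy := (p : Gm.TeamPlayer) → Strategy Gm.toGameStructure p.1
/-- An opponent strategy: one strategy for each player outside the team. -/
abbrev OppStrategy := (p : Gm.OppPlayer) → Strategy Gm.toGameStructure p.1

abbrev TeamAct := (p : Gm.TeamPlayer) → Gm.Act p.1
abbrev OppAct := (p : Gm.OppPlayer) → Gm.Act p.1

/-- A collective selector at state `s`. -/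
abbrev TeamSelector (s : Gm.State) := (p : Gm.TeamPlayer) → Selector Gm.toGameStructure p.1 s

def MemorylessTeam (σ : Gm.TeamStrategy) : Prop := ∀ p, (σ p).Memoryless
def DeterministicTeam (σ : Gm.TeamStrategy) : Prop := ∀ p, (σ p).Deterministic
def MemorylessOpp (τ : Gm.OppStrategy) : Prop := ∀ p, (τ p).Memoryless

/-- Combine a collective strategy and an opponent strategy into a full profile. -/
def combine (σ : Gm.TeamStrategy) (τ : Gm.OppStrategy) (p : Gm.Player) :
    Strategy Gm.toGameStructure p :=
  if h : p ∈ Gm.team then σ ⟨p, h⟩ else τ ⟨p, h⟩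

/-- Combine a joint team action and a joint opponent action into a full action profile. -/
def combineAct (a : Gm.TeamAct) (b : Gm.OppAct) (p : Gm.Player) : Gm.Act p :=
  if h : p ∈ Gm.team then a ⟨p, h⟩ else b ⟨p, h⟩

/-- A joint opponent action is available at `s`. -/
def OppAvailable (s : Gm.State) (b : Gm.OppAct) : Prop := ∀ p, b p ∈ Gm.Av p.1 s

/-- One-step transition probability, under a full strategy profile, from state `s`
with history `h`, to state `t` (players randomise independently). -/
def stepProb (π : (p : Gm.Player) → Strategy Gm.toGameStructure p)
    (h : List Gm.State) (s t : Gm.State) : ℝ :=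
  ∑ a : (p : Gm.Player) → Gm.Act p, (∏ p, (π p).toFun h s (a p)) * Gm.trans s a t

/-- Probability of visiting the target within `n` steps, starting at state `s`
with history `h`. -/
def reachWithin (π : (p : Gm.Player) → Strategy Gm.toGameStructure p) :
    ℕ → List Gm.State → Gm.State → ℝ
  | 0, _, s => if s ∈ Gm.target then 1 else 0
  | n + 1, h, s =>
      if s ∈ Gm.target then 1
      else ∑ t, Gm.stepProb π h s t * reachWithin π n (h ++ [s]) t

/-- Probability of eventually reaching the target set, starting from state `s`. -/
def reachProbFrom (π : (p : Gm.Player) → Strategy Gm.toGameStructure p) (s : Gm.State) : ℝ :=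
  ⨆ n : ℕ, Gm.reachWithin π n [] s

/-- Probability of eventually reaching the target set from the initial state. -/
def reachProb (π : (p : Gm.Player) → Strategy Gm.toGameStructure p) : ℝ :=
  Gm.reachProbFrom π Gm.init

/-- Probability of visiting the target set for the first time exactly at step `k`. -/
def firstHit (π : (p : Gm.Player) → Strategy Gm.toGameStructure p) :
    ℕ → List Gm.State → Gm.State → ℝ
  | 0, _, s => if s ∈ Gm.target then 1 else 0
  | k + 1, h, s =>
      if s ∈ Gm.target then 0
      else ∑ t, Gm.stepProb π h s t * firstHit π k (h ++ [s]) t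

/-- Expected `lam`-discounted payoff from the initial state: the play pays `lam ^ k`
if it first visits the target at step `k`, and `0` if it never visits the target. -/
def discounted (π : (p : Gm.Player) → Strategy Gm.toGameStructure p) (lam : ℝ) : ℝ :=
  ∑' k : ℕ, lam ^ k * Gm.firstHit π k [] Gm.init

/-- A play (an infinite sequence of states from the initial state) is compatible with
a strategy profile if each of its transitions occurs with positive probability. -/
def CompatiblePlay (π : (p : Gm.Player) → Strategy Gm.toGameStructure p)
    (play : ℕ → Gm.State) : Prop :=
  play 0 = Gm.init ∧
  ∀ n, 0 < Gm.stepProb π (List.ofFn fun i : Fin n => play i.1) (play n) (play (n + 1))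

/-- Expected value of the valuation `v` at the successor of `s`, when the team plays
according to the collective selector `ξ` and the opponent plays the joint action `b`. -/
def preTeamAct (v : Gm.State → ℝ) (s : Gm.State) (ξ : Gm.TeamSelector s) (b : Gm.OppAct) : ℝ :=
  ∑ a : Gm.TeamAct, (∏ p, (ξ p).toFun (a p)) * ∑ t, Gm.trans s (Gm.combineAct a b) t * v t

/-- An opponent selector at state `s`: a distribution over available joint opponent actions. -/
structure OppSelector (s : Gm.State) where
  toFun : Gm.OppAct → ℝ
  nonneg : ∀ b, 0 ≤ toFun b
  support_av : ∀ b, ¬ Gm.OppAvailable s b → toFun b = 0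
  sum_one : ∑ b, toFun b = 1

/-- Expected value of `v` at the successor of `s` under a collective selector `ξ`
and an opponent selector `ζ`. -/
def preSel (v : Gm.State → ℝ) (s : Gm.State) (ξ : Gm.TeamSelector s) (ζ : Gm.OppSelector s) : ℝ :=
  ∑ b, ζ.toFun b * Gm.preTeamAct v s ξ b

/-- The predecessor operator: best one-step value the team can guarantee. -/
def pre (v : Gm.State → ℝ) (s : Gm.State) : ℝ :=
  ⨆ ξ : Gm.TeamSelector s, ⨅ ζ : Gm.OppSelector s, Gm.preSel v s ξ ζ

/-- The value iteration sequence: `vIter 0` is the indicator of the target set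
and `vIter (n+1) = pre (vIter n)`. -/
def vIter : ℕ → Gm.State → ℝ
  | 0 => fun s => if s ∈ Gm.target then 1 else 0
  | n + 1 => Gm.pre (vIter n)

/-- The max-min value of the game started at `s`. -/
def maxminFrom (s : Gm.State) : ℝ :=
  ⨆ σ : Gm.TeamStrategy, ⨅ τ : Gm.OppStrategy, Gm.reachProbFrom (Gm.combine σ τ) s

/-- The set of states from which the team can win almost surely. -/
def winSet : Set Gm.State :=
  {s | ∃ σ : Gm.TeamStrategy, ∀ τ : Gm.OppStrategy, Gm.reachProbFrom (Gm.combine σ τ) s = 1}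

/-- Distribution of the successor of `s` when the team plays the collective
selector `ξ` and the opponent plays the joint action `b`. -/
def succProbSel (s : Gm.State) (ξ : Gm.TeamSelector s) (b : Gm.OppAct) (t : Gm.State) : ℝ :=
  ∑ a : Gm.TeamAct, (∏ p, (ξ p).toFun (a p)) * Gm.trans s (Gm.combineAct a b) t

/-- Distribution of the successor of `s` (with history `h`) when the team plays the
collective strategy `σ` and the opponent plays the joint action `b`. -/
def succProbTeam (σ : Gm.TeamStrategy) (h : List Gm.State) (s : Gm.State)
    (b : Gm.OppAct) (t : Gm.State) : ℝ :=
  ∑ a : Gm.TeamAct, (∏ p, (σ p).toFun h s (a p)) * Gm.trans s (Gm.combineAct a b) t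

/-- The layered decomposition of the almost-sure winning set. -/
def wSeq : ℕ → Set Gm.State
  | 0 => ↑Gm.target
  | k + 1 =>
      wSeq k ∪
      {s ∈ Gm.winSet | ∃ ξ : Gm.TeamSelector s, ∀ b : Gm.OppAct, Gm.OppAvailable s b →
        (0 < ∑ t, (wSeq k).indicator (Gm.succProbSel s ξ b) t) ∧
        (∑ t, Gm.winSet.indicator (Gm.succProbSel s ξ b) t = 1)}

end Game

open Filter Topology

namespace GameStructure

/-- The strategy playing deterministically the available action `β h s`. -/
def diracStrategy (G : GameStructure) (p : G.Player) (β : List G.State → G.State → G.Act p)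
    (hβ : ∀ h s, β h s ∈ G.Av p s) : Strategy G p where
  toFun h s a := if a = β h s then 1 else 0
  nonneg h s a := by split_ifs <;> norm_num
  support_av h s a ha := if_neg (by rintro rfl; exact ha (hβ h s))
  sum_one h s := by simp

end GameStructure

namespace Strategy

/-- The selector a strategy uses after a given history. -/
def selector {G : GameStructure} {p : G.Player} (σ : Strategy G p) (h : List G.State)
    (s : G.State) : Selector G p s where
  toFun := σ.toFun h s
  nonneg := σ.nonneg h s
  support_av := σ.support_av h s
  sum_one := σ.sum_one h s

end Strategy

namespace Game

variable (Gm : Game)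

lemma exists_oppAvailable (s : Gm.State) : ∃ b : Gm.OppAct, Gm.OppAvailable s b :=
  ⟨fun p => (Gm.av_nonempty p.1 s).choose, fun p => (Gm.av_nonempty p.1 s).choose_spec⟩

instance (s : Gm.State) : Nonempty (Gm.OppSelector s) := by
  classical
  obtain ⟨b, hb⟩ := Gm.exists_oppAvailable s
  exact ⟨{ toFun := fun b' => if b' = b then 1 else 0
           nonneg := fun b' => by split_ifs <;> norm_num
           support_av := fun b' h => if_neg (by rintro rfl; exact h hb)
           sum_one := by simp }⟩

instance (p : Gm.Player) (s : Gm.State) : Nonempty (Selector Gm.toGameStructure p s) := by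
  obtain ⟨a, ha⟩ := Gm.av_nonempty p s
  exact ⟨(Gm.diracStrategy p (fun _ s' => if s' = s then a else (Gm.av_nonempty p s').choose)
    (fun _ s' => by
      split_ifs with h
      · exact h ▸ ha
      · exact (Gm.av_nonempty p s').choose_spec)).selector [] s⟩

lemma sum_prod_teamSelector (s : Gm.State) (ξ : Gm.TeamSelector s) :
    ∑ a : Gm.TeamAct, ∏ p, (ξ p).toFun (a p) = 1 := by
  rw [← Fintype.piFinset_univ, ← Finset.prod_univ_sum]
  exact Finset.prod_eq_one fun p _ => (ξ p).sum_one

lemma prod_teamSelector_nonneg (s : Gm.State) (ξ : Gm.TeamSelector s) (a : Gm.TeamAct) :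
    0 ≤ ∏ p, (ξ p).toFun (a p) :=
  Finset.prod_nonneg fun p _ => (ξ p).nonneg _

variable {Gm}

lemma sum_mul_mem_Icc {ι : Type*} [Fintype ι] {f g : ι → ℝ} (hf : ∀ i, 0 ≤ f i)
    (hf1 : ∑ i, f i = 1) (hg : ∀ i, g i ∈ Set.Icc (0 : ℝ) 1) :
    ∑ i, f i * g i ∈ Set.Icc (0 : ℝ) 1 :=
  ⟨Finset.sum_nonneg fun i _ => mul_nonneg (hf i) (hg i).1,
    hf1 ▸ Finset.sum_le_sum fun i _ => mul_le_of_le_one_right (hf i) (hg i).2⟩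

lemma preTeamAct_mem_Icc {v : Gm.State → ℝ} (hv : ∀ t, v t ∈ Set.Icc (0 : ℝ) 1) (s : Gm.State)
    (ξ : Gm.TeamSelector s) (b : Gm.OppAct) : Gm.preTeamAct v s ξ b ∈ Set.Icc (0 : ℝ) 1 :=
  sum_mul_mem_Icc (Gm.prod_teamSelector_nonneg s ξ) (Gm.sum_prod_teamSelector s ξ) fun _ =>
    sum_mul_mem_Icc (Gm.trans_nonneg s _) (Gm.trans_sum s _) hv

lemma preSel_mem_Icc {v : Gm.State → ℝ} (hv : ∀ t, v t ∈ Set.Icc (0 : ℝ) 1) (s : Gm.State)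
    (ξ : Gm.TeamSelector s) (ζ : Gm.OppSelector s) : Gm.preSel v s ξ ζ ∈ Set.Icc (0 : ℝ) 1 :=
  sum_mul_mem_Icc ζ.nonneg ζ.sum_one (preTeamAct_mem_Icc hv s ξ)

lemma iInf_preSel_le_one {v : Gm.State → ℝ} (hv : ∀ t, v t ∈ Set.Icc (0 : ℝ) 1) (s : Gm.State)
    (ξ : Gm.TeamSelector s) : ⨅ ζ, Gm.preSel v s ξ ζ ≤ 1 :=
  ciInf_le_of_le ⟨0, by rintro _ ⟨ζ, rfl⟩; exact (preSel_mem_Icc hv s ξ ζ).1⟩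
    (Classical.arbitrary _) (preSel_mem_Icc hv s ξ _).2

lemma pre_mem_Icc {v : Gm.State → ℝ} (hv : ∀ t, v t ∈ Set.Icc (0 : ℝ) 1) (s : Gm.State) :
    Gm.pre v s ∈ Set.Icc (0 : ℝ) 1 :=
  ⟨Real.iSup_nonneg fun ξ => Real.iInf_nonneg fun ζ => (preSel_mem_Icc hv s ξ ζ).1,
    ciSup_le fun ξ => iInf_preSel_le_one hv s ξ⟩

lemma pre_eq_of_mem_target (v : Gm.State → ℝ) {s : Gm.State} (hs : s ∈ Gm.target) :
    Gm.pre v s = v s := by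
  have h_trans (a : (p : Gm.Player) → Gm.Act p) : ∑ t, Gm.trans s a t * v t = v s := by
    have h0 : ∀ t, t ≠ s → Gm.trans s a t = 0 := by
      intro t ht
      have h := Gm.trans_sum s a
      rw [← Finset.add_sum_erase _ _ (Finset.mem_univ s), Gm.absorbing s hs a, add_eq_left,
        Finset.sum_eq_zero_iff_of_nonneg fun _ _ => Gm.trans_nonneg _ _ _] at h
      exact h t (by simp [ht])
    rw [Finset.sum_eq_single s (fun t _ ht => by simp [h0 t ht]) (by simp), Gm.absorbing s hs a,
      one_mul]
  have h_sel (ξ : Gm.TeamSelector s) (ζ : Gm.OppSelector s) : Gm.preSel v s ξ ζ = v s := by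
    simp only [preSel, preTeamAct, h_trans, ← Finset.sum_mul, sum_prod_teamSelector, ζ.sum_one,
      one_mul]
  simp only [pre, h_sel, ciInf_const, ciSup_const]

lemma vIter_mem_Icc (n : ℕ) (s : Gm.State) : Gm.vIter n s ∈ Set.Icc (0 : ℝ) 1 := by
  induction n generalizing s with
  | zero => simp only [vIter]; split_ifs <;> simp
  | succ n ih => exact pre_mem_Icc ih s

lemma vIter_of_mem_target (n : ℕ) {s : Gm.State} (hs : s ∈ Gm.target) : Gm.vIter n s = 1 := by
  induction n with
  | zero => simp [vIter, hs]
  | succ n ih => exact (pre_eq_of_mem_target _ hs).trans ih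

/-- Against a fixed collective selector, some pure opponent action keeps the one-step value
below `pre`. -/
lemma exists_preTeamAct_le_pre {v : Gm.State → ℝ} (hv : ∀ t, v t ∈ Set.Icc (0 : ℝ) 1)
    (s : Gm.State) (ξ : Gm.TeamSelector s) :
    ∃ b, Gm.OppAvailable s b ∧ Gm.preTeamAct v s ξ b ≤ Gm.pre v s := by
  obtain ⟨b, hb, hmin⟩ := Set.exists_min_image {b | Gm.OppAvailable s b} (Gm.preTeamAct v s ξ)
    (Set.toFinite _) (Gm.exists_oppAvailable s)
  refine ⟨b, hb, le_ciSup_of_le ⟨1, ?_⟩ ξ (le_ciInf fun ζ => ?_)⟩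
  · rintro _ ⟨ξ', rfl⟩
    exact iInf_preSel_le_one hv s ξ'
  · calc Gm.preTeamAct v s ξ b = ∑ b', ζ.toFun b' * Gm.preTeamAct v s ξ b := by
          rw [← Finset.sum_mul, ζ.sum_one, one_mul]
      _ ≤ Gm.preSel v s ξ ζ := Finset.sum_le_sum fun b' _ => by
          by_cases h : Gm.OppAvailable s b'
          · exact mul_le_mul_of_nonneg_left (hmin b' h) (ζ.nonneg b')
          · simp [ζ.support_av b' h]

/-- Against a fixed collective selector, some pure opponent action keeps the one-step value
of the value iteration limit from increasing. -/
lemma exists_preTeamAct_le_limit {w : Gm.State → ℝ}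
    (hw : ∀ s, Tendsto (fun n => Gm.vIter n s) atTop (𝓝 (w s))) (s : Gm.State)
    (ξ : Gm.TeamSelector s) : ∃ b, Gm.OppAvailable s b ∧ Gm.preTeamAct w s ξ b ≤ w s := by
  by_contra! hlt
  have hev : ∀ b, Gm.OppAvailable s b →
      ∀ᶠ n in atTop, Gm.vIter (n + 1) s < Gm.preTeamAct (Gm.vIter n) s ξ b := fun b hb =>
    ((hw s).comp (tendsto_add_atTop_nat 1)).eventually_lt
      (tendsto_finsetSum _ fun a _ => (tendsto_finsetSum _ fun t _ =>
        (hw t).const_mul _).const_mul _) (hlt b hb)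
  obtain ⟨n, hn⟩ := (eventually_all.2 fun b => eventually_imp_distrib_left.2 (hev b)).exists
  obtain ⟨b, hb, hle⟩ := exists_preTeamAct_le_pre (vIter_mem_Icc n) s ξ
  exact (hn b hb).not_ge hle

lemma stepProb_combine_dirac (σ : Gm.TeamStrategy)
    (β : List Gm.State → Gm.State → Gm.OppAct) (hβ : ∀ h s, Gm.OppAvailable s (β h s))
    (h : List Gm.State) (s t : Gm.State) :
    Gm.stepProb (Gm.combine σ fun p =>
        Gm.diracStrategy p.1 (fun h s => β h s p) fun h s => hβ h s p) h s t =
      Gm.succProbTeam σ h s (β h s) t := by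
  rw [stepProb, ← (Equiv.piEquivPiSubtypeProd (· ∈ Gm.team) Gm.Act).symm.sum_comp,
    Fintype.sum_prod_type, succProbTeam]
  refine Finset.sum_congr rfl fun a _ => ?_
  have h_prod (b : Gm.OppAct) : ∏ p, (Gm.combine σ (fun p =>
      Gm.diracStrategy p.1 (fun h s => β h s p) fun h s => hβ h s p) p).toFun h s
        (Gm.combineAct a b p) =
      (∏ p, (σ p).toFun h s (a p)) * if b = β h s then 1 else 0 := by
    rw [← Fintype.prod_subtype_mul_prod_subtype (· ∈ Gm.team)]
    congr 1
    · exact Finset.prod_congr (by ext; simp) fun p _ => by simp [combine, combineAct, p.2]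
    · have h_factor (p : Gm.OppPlayer) : (Gm.combine σ (fun p =>
          Gm.diracStrategy p.1 (fun h s => β h s p) fun h s => hβ h s p) p).toFun h s
            (Gm.combineAct a b p) = if b p = β h s p then 1 else 0 := by
        simp [combine, combineAct, GameStructure.diracStrategy, p.2]
      simp [h_factor, Finset.prod_ite_zero, funext_iff]
  calc _ = ∑ b, (∏ p, (Gm.combine σ (fun p =>
      Gm.diracStrategy p.1 (fun h s => β h s p) fun h s => hβ h s p) p).toFun h s
        (Gm.combineAct a b p)) * Gm.trans s (Gm.combineAct a b) t := rfl
    _ = _ := by simp [h_prod]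

lemma sum_succProbTeam_mul (σ : Gm.TeamStrategy) (h : List Gm.State) (s : Gm.State)
    (b : Gm.OppAct) (v : Gm.State → ℝ) :
    ∑ t, Gm.succProbTeam σ h s b t * v t =
      Gm.preTeamAct v s (fun p => (σ p).selector h s) b := by
  simp only [succProbTeam, preTeamAct, Finset.sum_mul, Finset.mul_sum, mul_assoc]
  exact Finset.sum_comm

lemma stepProb_nonneg (π : (p : Gm.Player) → Strategy Gm.toGameStructure p)
    (h : List Gm.State) (s t : Gm.State) : 0 ≤ Gm.stepProb π h s t :=
  Finset.sum_nonneg fun _ _ => mul_nonneg (Finset.prod_nonneg fun p _ => (π p).nonneg _ _ _)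
    (Gm.trans_nonneg _ _ _)

/-- A valuation that is at least one on the target, nonnegative, and non-increasing in expectation
under the strategy profile bounds the reachability probability. -/
lemma reachWithin_le {π : (p : Gm.Player) → Strategy Gm.toGameStructure p} {w : Gm.State → ℝ}
    (hw0 : ∀ s, 0 ≤ w s) (hw1 : ∀ s ∈ Gm.target, 1 ≤ w s)
    (hstep : ∀ h s, ∑ t, Gm.stepProb π h s t * w t ≤ w s) (n : ℕ) (h : List Gm.State)
    (s : Gm.State) : Gm.reachWithin π n h s ≤ w s := by
  induction n generalizing h s with
  | zero =>
    rw [reachWithin]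
    split_ifs with hs
    exacts [hw1 s hs, hw0 s]
  | succ n ih =>
    rw [reachWithin]
    split_ifs with hs
    · exact hw1 s hs
    · exact (Finset.sum_le_sum fun t _ => mul_le_mul_of_nonneg_left (ih _ t)
        (stepProb_nonneg π h s t)).trans (hstep h s)

end Game

/-- For every state `s` and every collective strategy, the opponent
has a response keeping the reachability probability at most `w s`, where `w` is
the pointwise limit of the value iteration sequence; in particular no collective
strategy guarantees strictly more than `w s` against every opponent strategy. -/
theorem opponent_can_keep_below_limit (Gm : Game) (w : Gm.State → ℝ)
    (hw : ∀ s, Filter.Tendsto (fun n => Gm.vIter n s) Filter.atTop (nhds (w s))) :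
    (∀ (s : Gm.State) (σ : Gm.TeamStrategy), ∃ τ : Gm.OppStrategy,
        Gm.reachProbFrom (Gm.combine σ τ) s ≤ w s) ∧
    (∀ (s : Gm.State) (σ : Gm.TeamStrategy),
        ¬ ∀ τ : Gm.OppStrategy, w s < Gm.reachProbFrom (Gm.combine σ τ) s) := by
  have hopp (s : Gm.State) (σ : Gm.TeamStrategy) : ∃ τ : Gm.OppStrategy,
      Gm.reachProbFrom (Gm.combine σ τ) s ≤ w s := by
    choose β hβ hle using fun (h : List Gm.State) (s : Gm.State) =>
      Game.exists_preTeamAct_le_limit hw s fun p => (σ p).selector h s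
    refine ⟨fun p => Gm.diracStrategy p.1 (fun h s => β h s p) fun h s => hβ h s p,
      ciSup_le fun n => Game.reachWithin_le
        (fun s => ge_of_tendsto' (hw s) fun n => (Game.vIter_mem_Icc n s).1)
        (fun s hs => ge_of_tendsto' (hw s) fun n => (Game.vIter_of_mem_target n hs).ge)
        (fun h s => ?_) n [] s⟩
    simpa only [Game.stepProb_combine_dirac, Game.sum_succProbTeam_mul] using hle h s
  exact ⟨hopp, fun s σ hall => let ⟨τ, hτ⟩ := hopp s σ; (hall τ).not_ge hτ⟩
end
end

section
/- Let t ∈ [0,1]. If there exists a collective strategy for the team guaranteeing that the target set T is reached from the initial state with probability strictly greater than t against every opponent strategy, then there exist a discount factor λ ∈ (0,1) and a memoryless collective strategy whose expected λ-discounted payoff against every opponent strategy is strictly greater than t. -/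
/-!
Common framework: team concurrent stochastic reachability games.
-/

noncomputable section

namespace Game

variable {Gm : Game}

/-- The finite set of available joint opponent actions. -/
def oppActs (Gm : Game) (s : Gm.State) : Finset Gm.OppAct :=
  Fintype.piFinset fun p => Gm.Av p.1 s

lemma oppActs_nonempty (Gm : Game) (s : Gm.State) : (Gm.oppActs s).Nonempty :=
  Fintype.piFinset_nonempty.2 fun p => Gm.av_nonempty p.1 s

lemma succProbTeam_nonneg (σ : Gm.TeamStrategy) (h : List Gm.State) (s : Gm.State)
    (b : Gm.OppAct) (t : Gm.State) : 0 ≤ Gm.succProbTeam σ h s b t :=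
  Finset.sum_nonneg fun _ _ =>
    mul_nonneg (Finset.prod_nonneg fun p _ => (σ p).nonneg _ _ _) (Gm.trans_nonneg _ _ _)

lemma sum_succProbTeam (σ : Gm.TeamStrategy) (h : List Gm.State) (s : Gm.State)
    (b : Gm.OppAct) : ∑ t, Gm.succProbTeam σ h s b t = 1 := by
  unfold succProbTeam
  rw [Finset.sum_comm]
  simp_rw [← Finset.mul_sum, Gm.trans_sum, mul_one]
  rw [← Fintype.prod_sum fun (p : Gm.TeamPlayer) (a : Gm.Act p.1) => (σ p).toFun h s a]
  simp [Strategy.sum_one]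

/-- The probability that the opponent players choose the joint action `b`. -/
def oppWeight (τ : Gm.OppStrategy) (h : List Gm.State) (s : Gm.State) (b : Gm.OppAct) : ℝ :=
  ∏ p, (τ p).toFun h s (b p)

lemma oppWeight_nonneg (τ : Gm.OppStrategy) (h : List Gm.State) (s : Gm.State)
    (b : Gm.OppAct) : 0 ≤ oppWeight τ h s b :=
  Finset.prod_nonneg fun p _ => (τ p).nonneg _ _ _

lemma oppWeight_eq_zero (τ : Gm.OppStrategy) (h : List Gm.State) (s : Gm.State)
    {b : Gm.OppAct} (hb : b ∉ Gm.oppActs s) : oppWeight τ h s b = 0 := by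
  simp only [oppActs, Fintype.mem_piFinset, not_forall] at hb
  obtain ⟨p, hp⟩ := hb
  exact Finset.prod_eq_zero (Finset.mem_univ p) ((τ p).support_av _ _ _ hp)

lemma sum_oppWeight (τ : Gm.OppStrategy) (h : List Gm.State) (s : Gm.State) :
    ∑ b, oppWeight τ h s b = 1 := by
  unfold oppWeight
  rw [← Fintype.prod_sum fun (p : Gm.OppPlayer) (a : Gm.Act p.1) => (τ p).toFun h s a]
  simp [Strategy.sum_one]

lemma stepProb_combine (σ : Gm.TeamStrategy) (τ : Gm.OppStrategy) (h : List Gm.State)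
    (s t : Gm.State) :
    Gm.stepProb (Gm.combine σ τ) h s t =
      ∑ b, oppWeight τ h s b * Gm.succProbTeam σ h s b t := by
  unfold stepProb succProbTeam
  simp_rw [Finset.mul_sum]
  rw [Finset.sum_comm, ← Fintype.sum_prod_type',
    ← (Equiv.piEquivPiSubtypeProd (· ∈ Gm.team) Gm.Act).symm.sum_comp]
  refine Finset.sum_congr rfl fun x _ => ?_
  have hact : (Equiv.piEquivPiSubtypeProd (· ∈ Gm.team) Gm.Act).symm x =
      Gm.combineAct x.1 x.2 := rfl
  rw [hact, ← Fintype.prod_subtype_mul_prod_subtype (· ∈ Gm.team), ← mul_assoc,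
    mul_comm (oppWeight _ _ _ _)]
  unfold oppWeight
  congr 2
  · refine Finset.prod_congr (by ext; simp) fun p _ => ?_
    simp [combine, combineAct, p.2]
  · refine Finset.prod_congr rfl fun p _ => ?_
    simp [combine, combineAct, p.2]

lemma stepProb_combine_nonneg (σ : Gm.TeamStrategy) (τ : Gm.OppStrategy) (h : List Gm.State)
    (s t : Gm.State) : 0 ≤ Gm.stepProb (Gm.combine σ τ) h s t := by
  rw [stepProb_combine]
  exact Finset.sum_nonneg fun b _ =>
    mul_nonneg (oppWeight_nonneg _ _ _ _) (succProbTeam_nonneg _ _ _ _ _)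

lemma sum_stepProb_combine_mul (σ : Gm.TeamStrategy) (τ : Gm.OppStrategy) (h : List Gm.State)
    (s : Gm.State) (f : Gm.State → ℝ) :
    ∑ t, Gm.stepProb (Gm.combine σ τ) h s t * f t =
      ∑ b, oppWeight τ h s b * ∑ t, Gm.succProbTeam σ h s b t * f t := by
  simp_rw [stepProb_combine, Finset.sum_mul, Finset.mul_sum, mul_assoc]
  exact Finset.sum_comm

lemma sum_stepProb_combine (σ : Gm.TeamStrategy) (τ : Gm.OppStrategy) (h : List Gm.State)
    (s : Gm.State) : ∑ t, Gm.stepProb (Gm.combine σ τ) h s t = 1 := by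
  simpa [sum_succProbTeam, sum_oppWeight] using sum_stepProb_combine_mul σ τ h s fun _ => 1

/-- A lower bound against every available joint opponent action is a lower bound against
every opponent strategy. -/
lemma le_sum_stepProb_combine_mul (σ : Gm.TeamStrategy) (τ : Gm.OppStrategy)
    (h : List Gm.State) (s : Gm.State) (f : Gm.State → ℝ) {c : ℝ}
    (hc : ∀ b ∈ Gm.oppActs s, c ≤ ∑ t, Gm.succProbTeam σ h s b t * f t) :
    c ≤ ∑ t, Gm.stepProb (Gm.combine σ τ) h s t * f t := by
  rw [sum_stepProb_combine_mul, ← one_mul c, ← sum_oppWeight τ h s, Finset.sum_mul]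
  refine Finset.sum_le_sum fun b _ => ?_
  by_cases hb : b ∈ Gm.oppActs s
  · exact mul_le_mul_of_nonneg_left (hc b hb) (oppWeight_nonneg _ _ _ _)
  · simp [oppWeight_eq_zero τ h s hb]

/-- The opponent strategy that plays the joint action `β h s` with probability one. -/
def pureOpp (β : List Gm.State → Gm.State → Gm.OppAct) (hβ : ∀ h s, β h s ∈ Gm.oppActs s) :
    Gm.OppStrategy := fun p =>
  { toFun := fun h s a => if a = β h s p then 1 else 0
    nonneg := fun h s a => by split_ifs <;> norm_num
    support_av := fun h s a ha =>
      if_neg fun e : a = β h s p => ha (e ▸ Fintype.mem_piFinset.1 (hβ h s) p)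
    sum_one := fun h s => by simp }

lemma oppWeight_pureOpp (β : List Gm.State → Gm.State → Gm.OppAct)
    (hβ : ∀ h s, β h s ∈ Gm.oppActs s) (h : List Gm.State) (s : Gm.State) (b : Gm.OppAct) :
    oppWeight (pureOpp β hβ) h s b = if b = β h s then 1 else 0 := by
  simp only [oppWeight, pureOpp, Finset.prod_boole, Finset.mem_univ, true_imp_iff, funext_iff]

/-- The probability of visiting the target within `n` steps that `σ` guarantees. -/
def guaranteed (σ : Gm.TeamStrategy) : ℕ → List Gm.State → Gm.State → ℝ
  | 0, _, s => if s ∈ Gm.target then 1 else 0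
  | n + 1, h, s =>
      if s ∈ Gm.target then 1
      else (Gm.oppActs s).inf' (Gm.oppActs_nonempty s) fun b =>
        ∑ t, Gm.succProbTeam σ h s b t * guaranteed σ n (h ++ [s]) t

lemma guaranteed_nonneg (σ : Gm.TeamStrategy) (n : ℕ) (h : List Gm.State) (s : Gm.State) :
    0 ≤ guaranteed σ n h s := by
  induction n generalizing h s with
  | zero => unfold guaranteed; split_ifs <;> norm_num
  | succ n ih =>
    unfold guaranteed
    split_ifs
    · norm_num
    · exact Finset.le_inf' _ _ fun b _ => Finset.sum_nonneg fun t _ =>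
        mul_nonneg (succProbTeam_nonneg _ _ _ _ _) (ih _ _)

lemma guaranteed_le_one (σ : Gm.TeamStrategy) (n : ℕ) (h : List Gm.State) (s : Gm.State) :
    guaranteed σ n h s ≤ 1 := by
  induction n generalizing h s with
  | zero => unfold guaranteed; split_ifs <;> norm_num
  | succ n ih =>
    unfold guaranteed
    split_ifs
    · norm_num
    · obtain ⟨b, hb⟩ := Gm.oppActs_nonempty s
      refine (Finset.inf'_le _ hb).trans ?_
      rw [← sum_succProbTeam σ h s b]
      exact Finset.sum_le_sum fun t _ =>
        mul_le_of_le_one_right (succProbTeam_nonneg _ _ _ _ _) (ih _ _)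

lemma guaranteed_le_succ (σ : Gm.TeamStrategy) (n : ℕ) (h : List Gm.State) (s : Gm.State) :
    guaranteed σ n h s ≤ guaranteed σ (n + 1) h s := by
  induction n generalizing h s with
  | zero =>
    by_cases hs : s ∈ Gm.target
    · simp [guaranteed, hs]
    · simpa only [guaranteed, hs, if_false] using guaranteed_nonneg σ 1 h s
  | succ n ih =>
    by_cases hs : s ∈ Gm.target
    · simp [guaranteed, hs]
    · rw [guaranteed, guaranteed, if_neg hs, if_neg hs]
      refine Finset.le_inf' _ _ fun b hb => (Finset.inf'_le _ hb).trans ?_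
      exact Finset.sum_le_sum fun t _ =>
        mul_le_mul_of_nonneg_left (ih _ _) (succProbTeam_nonneg _ _ _ _ _)

lemma guaranteed_monotone (σ : Gm.TeamStrategy) (h : List Gm.State) (s : Gm.State) :
    Monotone fun n => guaranteed σ n h s :=
  monotone_nat_of_le_succ fun n => guaranteed_le_succ σ n h s

lemma bddAbove_guaranteed (σ : Gm.TeamStrategy) (h : List Gm.State) (s : Gm.State) :
    BddAbove (Set.range fun n => guaranteed σ n h s) :=
  ⟨1, by rintro _ ⟨n, rfl⟩; exact guaranteed_le_one σ n h s⟩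

lemma tendsto_guaranteed (σ : Gm.TeamStrategy) (h : List Gm.State) (s : Gm.State) :
    Filter.Tendsto (fun n => guaranteed σ n h s) Filter.atTop
      (nhds (⨆ n, guaranteed σ n h s)) :=
  tendsto_atTop_ciSup (guaranteed_monotone σ h s) (bddAbove_guaranteed σ h s)

lemma exists_oppAct_sum_iSup_guaranteed_le (σ : Gm.TeamStrategy) (h : List Gm.State)
    (s : Gm.State) : ∃ b ∈ Gm.oppActs s, s ∉ Gm.target →
      ∑ t, Gm.succProbTeam σ h s b t * (⨆ n, guaranteed σ n (h ++ [s]) t) ≤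
        ⨆ n, guaranteed σ n h s := by
  by_contra! hcon
  obtain ⟨b₀, hb₀⟩ := Gm.oppActs_nonempty s
  have hs := (hcon b₀ hb₀).1
  have hev : ∀ᶠ n in Filter.atTop, ∀ b ∈ Gm.oppActs s, (⨆ n, guaranteed σ n h s) <
      ∑ t, Gm.succProbTeam σ h s b t * guaranteed σ n (h ++ [s]) t := by
    rw [Filter.eventually_all_finset]
    intro b hb
    exact (tendsto_finsetSum _ fun t _ =>
      (tendsto_guaranteed σ (h ++ [s]) t).const_mul _).eventually_const_lt (hcon b hb).2
  obtain ⟨n, hn⟩ := hev.exists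
  have hlt : (⨆ n, guaranteed σ n h s) < guaranteed σ (n + 1) h s := by
    rw [guaranteed, if_neg hs, Finset.lt_inf'_iff]
    exact hn
  exact hlt.not_ge (le_ciSup (bddAbove_guaranteed σ h s) (n + 1))

/-- Some opponent strategy keeps the reachability probability down to the limit of the
guaranteed step-bounded probabilities. -/
lemma exists_reachProb_le_iSup_guaranteed (σ : Gm.TeamStrategy) :
    ∃ τ : Gm.OppStrategy, Gm.reachProb (Gm.combine σ τ) ≤ ⨆ n, guaranteed σ n [] Gm.init := by
  choose β hβ hle using exists_oppAct_sum_iSup_guaranteed_le σ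
  refine ⟨pureOpp β hβ, ciSup_le fun n => ?_⟩
  suffices H : ∀ h s, Gm.reachWithin (Gm.combine σ (pureOpp β hβ)) n h s ≤
      ⨆ n, guaranteed σ n h s from H [] Gm.init
  induction n with
  | zero => exact fun h s => le_ciSup (bddAbove_guaranteed σ h s) 0
  | succ n ih =>
    intro h s
    by_cases hs : s ∈ Gm.target
    · simpa [reachWithin, guaranteed, hs] using le_ciSup (bddAbove_guaranteed σ h s) 0
    · rw [reachWithin, if_neg hs, sum_stepProb_combine_mul]
      simp only [oppWeight_pureOpp, ite_mul, one_mul, zero_mul, Finset.sum_ite_eq',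
        Finset.mem_univ, if_true]
      refine le_trans (Finset.sum_le_sum fun t _ => ?_) (hle h s hs)
      exact mul_le_mul_of_nonneg_left (ih _ _) (succProbTeam_nonneg _ _ _ _ _)

lemma firstHit_mem_Icc (σ : Gm.TeamStrategy) (τ : Gm.OppStrategy) (k : ℕ) (h : List Gm.State)
    (s : Gm.State) : Gm.firstHit (Gm.combine σ τ) k h s ∈ Set.Icc (0 : ℝ) 1 := by
  induction k generalizing h s with
  | zero => unfold firstHit; split_ifs <;> simp
  | succ k ih =>
    unfold firstHit
    split_ifs
    · simp
    · refine ⟨Finset.sum_nonneg fun t _ =>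
        mul_nonneg (stepProb_combine_nonneg _ _ _ _ _) (ih _ _).1, ?_⟩
      rw [← sum_stepProb_combine σ τ h s]
      exact Finset.sum_le_sum fun t _ =>
        mul_le_of_le_one_right (stepProb_combine_nonneg _ _ _ _ _) (ih _ _).2

/-- A valuation bounded by one that satisfies the discounted optimality inequality against
every available joint opponent action is a lower bound for the discounted payoff. -/
lemma le_discounted (σ : Gm.TeamStrategy) (τ : Gm.OppStrategy) {lam : ℝ} (h0 : 0 < lam)
    (h1 : lam < 1) (V : Gm.State → ℝ) (hV : ∀ s, V s ≤ 1)
    (hstep : ∀ h, ∀ s ∉ Gm.target, ∀ b ∈ Gm.oppActs s,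
      V s ≤ lam * ∑ t, Gm.succProbTeam σ h s b t * V t) :
    V Gm.init ≤ Gm.discounted (Gm.combine σ τ) lam := by
  have key : ∀ n h s, V s - lam ^ n ≤
      ∑ k ∈ Finset.range n, lam ^ k * Gm.firstHit (Gm.combine σ τ) k h s := by
    intro n
    induction n with
    | zero => intro h s; simpa using hV s
    | succ n ih =>
      intro h s
      rw [Finset.sum_range_succ']
      by_cases hs : s ∈ Gm.target
      · simp only [firstHit, hs, if_true, mul_zero, Finset.sum_const_zero, pow_zero, mul_one]
        linarith [hV s, pow_pos h0 (n + 1)]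
      · simp only [firstHit, hs, if_false, mul_zero, add_zero]
        have hsum : ∑ k ∈ Finset.range n, lam ^ (k + 1) *
            ∑ t, Gm.stepProb (Gm.combine σ τ) h s t *
              Gm.firstHit (Gm.combine σ τ) k (h ++ [s]) t =
            lam * ∑ t, Gm.stepProb (Gm.combine σ τ) h s t *
              ∑ k ∈ Finset.range n, lam ^ k *
                Gm.firstHit (Gm.combine σ τ) k (h ++ [s]) t := by
          simp_rw [Finset.mul_sum]
          rw [Finset.sum_comm]
          exact Finset.sum_congr rfl fun t _ => Finset.sum_congr rfl fun k _ => by ring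
        rw [hsum]
        have hpre : V s / lam ≤ ∑ t, Gm.stepProb (Gm.combine σ τ) h s t * V t :=
          le_sum_stepProb_combine_mul σ τ h s V fun b hb => by
            rw [div_le_iff₀' h0]
            exact hstep h s hs b hb
        have hle : ∑ t, Gm.stepProb (Gm.combine σ τ) h s t * (V t - lam ^ n) ≤
            ∑ t, Gm.stepProb (Gm.combine σ τ) h s t * ∑ k ∈ Finset.range n, lam ^ k *
                Gm.firstHit (Gm.combine σ τ) k (h ++ [s]) t :=
          Finset.sum_le_sum fun t _ =>
            mul_le_mul_of_nonneg_left (ih _ _) (stepProb_combine_nonneg _ _ _ _ _)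
        simp_rw [mul_sub, Finset.sum_sub_distrib, ← Finset.sum_mul,
          sum_stepProb_combine, one_mul] at hle
        calc V s - lam ^ (n + 1) = lam * (V s / lam - lam ^ n) := by
              field_simp
              ring
          _ ≤ _ := mul_le_mul_of_nonneg_left (by linarith) h0.le
  have hnonneg : ∀ k, 0 ≤ lam ^ k * Gm.firstHit (Gm.combine σ τ) k [] Gm.init := fun k =>
    mul_nonneg (pow_nonneg h0.le k) (firstHit_mem_Icc σ τ k _ _).1
  have hsummable : Summable fun k => lam ^ k * Gm.firstHit (Gm.combine σ τ) k [] Gm.init :=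
    (summable_geometric_of_lt_one h0.le h1).of_nonneg_of_le hnonneg fun k =>
      mul_le_of_le_one_right (pow_nonneg h0.le k) (firstHit_mem_Icc σ τ k _ _).2
  have hlim : Filter.Tendsto (fun n : ℕ => V Gm.init - lam ^ n) Filter.atTop
      (nhds (V Gm.init)) := by
    simpa using (tendsto_pow_atTop_nhds_zero_of_lt_one h0.le h1).const_sub (V Gm.init)
  exact le_of_tendsto' hlim fun n =>
    (key n [] Gm.init).trans (hsummable.sum_le_tsum _ fun k _ => hnonneg k)

/-- The supremum, over all histories and horizons, of the guaranteed step-bounded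
reachability probability discounted by the horizon. -/
def discountedSup (σ : Gm.TeamStrategy) (lam : ℝ) (s : Gm.State) : ℝ :=
  ⨆ x : List Gm.State × ℕ, lam ^ x.2 * guaranteed σ x.2 x.1 s

lemma pow_mul_guaranteed_le_one (σ : Gm.TeamStrategy) {lam : ℝ} (h0 : 0 < lam) (h1 : lam < 1)
    (n : ℕ) (h : List Gm.State) (s : Gm.State) :
    lam ^ n * guaranteed σ n h s ≤ 1 :=
  mul_le_one₀ (pow_le_one₀ h0.le h1.le) (guaranteed_nonneg σ n h s) (guaranteed_le_one σ n h s)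

lemma discountedSup_le_one (σ : Gm.TeamStrategy) {lam : ℝ} (h0 : 0 < lam) (h1 : lam < 1)
    (s : Gm.State) : discountedSup σ lam s ≤ 1 :=
  ciSup_le fun x => pow_mul_guaranteed_le_one σ h0 h1 x.2 x.1 s

lemma le_discountedSup (σ : Gm.TeamStrategy) {lam : ℝ} (h0 : 0 < lam) (h1 : lam < 1)
    (n : ℕ) (h : List Gm.State) (s : Gm.State) :
    lam ^ n * guaranteed σ n h s ≤ discountedSup σ lam s :=
  le_ciSup (f := fun x : List Gm.State × ℕ => lam ^ x.2 * guaranteed σ x.2 x.1 s)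
    ⟨1, by rintro _ ⟨x, rfl⟩; exact pow_mul_guaranteed_le_one σ h0 h1 x.2 x.1 s⟩ (h, n)

lemma discountedSup_nonneg (σ : Gm.TeamStrategy) {lam : ℝ} (h0 : 0 < lam) (h1 : lam < 1)
    (s : Gm.State) : 0 ≤ discountedSup σ lam s :=
  (mul_nonneg (pow_nonneg h0.le 0) (guaranteed_nonneg σ 0 [] s)).trans
    (le_discountedSup σ h0 h1 0 [] s)

/-- Relaxing the discount factor, the choice of `σ` after a suitable history satisfies the
discounted optimality inequality. -/
lemma exists_history_discountedSup_le (σ : Gm.TeamStrategy) {lam : ℝ} (h0 : 0 < lam) (h1 : lam < 1)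
    {mu : ℝ} (hmu : lam < mu) (s : Gm.State) :
    ∃ h : List Gm.State, s ∉ Gm.target → ∀ b ∈ Gm.oppActs s, discountedSup σ lam s ≤
      mu * ∑ t, Gm.succProbTeam σ h s b t * discountedSup σ lam t := by
  have hmu0 : 0 < mu := h0.trans hmu
  rcases (discountedSup_nonneg σ h0 h1 s).eq_or_lt with hz | hpos
  · refine ⟨[], fun _ b _ => hz ▸ mul_nonneg hmu0.le (Finset.sum_nonneg fun t _ => ?_)⟩
    exact mul_nonneg (succProbTeam_nonneg _ _ _ _ _) (discountedSup_nonneg σ h0 h1 t)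
  · have hlt : lam / mu * discountedSup σ lam s < discountedSup σ lam s :=
      mul_lt_of_lt_one_left hpos ((div_lt_one hmu0).2 hmu)
    obtain ⟨⟨h, n⟩, hn⟩ := exists_lt_of_lt_ciSup hlt
    refine ⟨h, fun hs b hb => ?_⟩
    have hq : 0 < lam / mu * discountedSup σ lam s := mul_pos (div_pos h0 hmu0) hpos
    cases n with
    | zero =>
      simp only [guaranteed, hs, if_false, mul_zero] at hn
      exact absurd hn hq.not_gt
    | succ n =>
      simp only [guaranteed, hs, if_false] at hn
      have hb' := Finset.inf'_le
        (fun b => ∑ t, Gm.succProbTeam σ h s b t * guaranteed σ n (h ++ [s]) t) hb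
      have hle : lam / mu * discountedSup σ lam s ≤
          lam * ∑ t, Gm.succProbTeam σ h s b t * discountedSup σ lam t := by
        refine hn.le.trans ((mul_le_mul_of_nonneg_left hb' (pow_nonneg h0.le _)).trans ?_)
        rw [pow_succ', mul_assoc, Finset.mul_sum]
        refine mul_le_mul_of_nonneg_left (Finset.sum_le_sum fun t _ => ?_) h0.le
        rw [mul_left_comm]
        exact mul_le_mul_of_nonneg_left (le_discountedSup σ h0 h1 n _ t)
          (succProbTeam_nonneg _ _ _ _ _)
      rw [div_mul_eq_mul_div, mul_div_assoc] at hle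
      rw [← div_le_iff₀' hmu0]
      exact le_of_mul_le_mul_left hle h0

/-- The memoryless strategy that plays at each state `s` as `σ` does after the history `H s`. -/
def freeze (σ : Gm.TeamStrategy) (H : Gm.State → List Gm.State) : Gm.TeamStrategy := fun p =>
  { toFun := fun _ s => (σ p).toFun (H s) s
    nonneg := fun _ s => (σ p).nonneg (H s) s
    support_av := fun _ s => (σ p).support_av (H s) s
    sum_one := fun _ s => (σ p).sum_one (H s) s }

lemma memorylessTeam_freeze (σ : Gm.TeamStrategy) (H : Gm.State → List Gm.State) :
    Gm.MemorylessTeam (freeze σ H) :=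
  fun _ _ _ _ => rfl

lemma exists_discount_lt_pow_mul (n : ℕ) {t w : ℝ} (htw : t < w) :
    ∃ lam : ℝ, 0 < lam ∧ lam < 1 ∧ t < lam ^ n * w := by
  have hlim : Filter.Tendsto (fun x : ℝ => x ^ n * w) (nhdsWithin 1 (Set.Iio 1)) (nhds w) := by
    have hc : Continuous fun x : ℝ => x ^ n * w := by fun_prop
    simpa using (hc.tendsto 1).mono_left nhdsWithin_le_nhds
  obtain ⟨x, hx, hx'⟩ := ((hlim.eventually_const_lt htw).and
    (Ioo_mem_nhdsLT (zero_lt_one' ℝ))).exists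
  exact ⟨x, hx'.1, hx'.2, hx⟩

end Game

/-- If some collective strategy reaches the target with probability
strictly greater than `t` against every opponent strategy, then there are a
discount factor `λ ∈ (0,1)` and a memoryless collective strategy whose expected
`λ`-discounted payoff strictly exceeds `t` against every opponent strategy. -/
theorem discounted_memoryless_witness (Gm : Game) (t : ℝ) (ht0 : 0 ≤ t) (ht1 : t ≤ 1)
    (h : ∃ σ : Gm.TeamStrategy, ∀ τ : Gm.OppStrategy, t < Gm.reachProb (Gm.combine σ τ)) :
    ∃ lam : ℝ, 0 < lam ∧ lam < 1 ∧
      ∃ σ : Gm.TeamStrategy, Gm.MemorylessTeam σ ∧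
        ∀ τ : Gm.OppStrategy, t < Gm.discounted (Gm.combine σ τ) lam := by
  obtain ⟨σ, hσ⟩ := h
  obtain ⟨τ, hτ⟩ := Game.exists_reachProb_le_iSup_guaranteed σ
  obtain ⟨n, hn⟩ := exists_lt_of_lt_ciSup ((hσ τ).trans_le hτ)
  obtain ⟨lam, h0, h1, hlam⟩ := Game.exists_discount_lt_pow_mul n hn
  obtain ⟨mu, hmu, hmu1⟩ := exists_between h1
  choose H hH using Game.exists_history_discountedSup_le σ h0 h1 hmu
  refine ⟨mu, h0.trans hmu, hmu1, Game.freeze σ H, Game.memorylessTeam_freeze σ H, fun τ => ?_⟩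
  exact hlam.trans_le ((Game.le_discountedSup σ h0 h1 n [] Gm.init).trans
    (Game.le_discounted _ τ (h0.trans hmu) hmu1 _ (Game.discountedSup_le_one σ h0 h1)
      fun _ s hs b hb => hH s hs b hb))
end
end
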